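/- Let G be a finite 2-connected bipartite simple graph, let v be a vertex of G, and suppose G contains an even cycle C through v together with a chordal path to C that separates v and v̄_C. Then G has two level-disjoint partitions rooted at v. -/

import Mathlib

open SimpleGraph

variable {V : Type*}

/-- `L = (S_0, …, S_h)` is a level partition of the vertex set `U` with respect to the
adjacency relation `Adj`: the levels are nonempty, pairwise disjoint, their union is `U`,
and every vertex of a level `S_i` (`i ≥ 1`) has a neighbor in the previous level `S_{i-1}`. -/
def IsLevelPartitionOn (Adj : V → V → Prop) (U : Set V) (L : List (Finset V)) : Prop :=
  L ≠ [] ∧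
  (∀ i, i < L.length → (L.getD i ∅).Nonempty) ∧
  (∀ i j, i < L.length → j < L.length → i ≠ j → Disjoint (L.getD i ∅) (L.getD j ∅)) ∧
  (∀ x : V, x ∈ U ↔ ∃ i < L.length, x ∈ L.getD i ∅) ∧
  (∀ i, 1 ≤ i → i < L.length → ∀ u ∈ L.getD i ∅, ∃ w ∈ L.getD (i - 1) ∅, Adj u w)

/-- A level partition of the graph `G` (on its whole vertex set). -/
def IsLevelPartition (G : SimpleGraph V) (L : List (Finset V)) : Prop :=
  IsLevelPartitionOn G.Adj Set.univ L

/-- A level partition is rooted at `v` if its level `0` is the singleton `{v}`. -/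
def RootedAt (v : V) (L : List (Finset V)) : Prop :=
  L.getD 0 ∅ = {v}

/-- Two level partitions are level-disjoint if their levels `i` are disjoint
for every `1 ≤ i ≤ min(h, h')`. -/
def LevelDisjoint (L M : List (Finset V)) : Prop :=
  ∀ i, 1 ≤ i → i < L.length → i < M.length → Disjoint (L.getD i ∅) (M.getD i ∅)

/-- The induced subgraph of `G` on `U` has no cut-vertex: deleting any vertex of `U`
leaves it preconnected. -/
def NoCutVertexOn (G : SimpleGraph V) (U : Set V) : Prop :=
  ∀ x ∈ U, (G.induce (U \ {x})).Preconnected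

/-- `U` induces a block of `G`: a maximal connected induced subgraph without a cut-vertex. -/
def IsBlockSet (G : SimpleGraph V) (U : Set V) : Prop :=
  (G.induce U).Connected ∧ NoCutVertexOn G U ∧
  ∀ W : Set V, U ⊆ W → (G.induce W).Connected → NoCutVertexOn G W → W = U

/-- The induced subgraph of `G` on `U` is 2-connected: connected, with at least 3 vertices
and no cut-vertex. -/
def TwoConnectedOn (G : SimpleGraph V) (U : Set V) : Prop :=
  (G.induce U).Connected ∧ 3 ≤ U.ncard ∧ NoCutVertexOn G U

/-- Inside the vertex set `U`, the graph `G` has an even cycle `C = (vAu, uDw, wBv)`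
through `v` together with a chordal path `P` to `C` (with endvertices `u, w`) that
separates `v` and the opposite vertex `v̄_C`, i.e. the vertex at distance `|C|/2` from `v`
along `C` is an internal vertex of `D` (while `v` lies internally on the other arc). -/
def HasSepChordalCycleIn (G : SimpleGraph V) (U : Set V) (v : V) : Prop :=
  ∃ (u w : V) (A : G.Walk v u) (D : G.Walk u w) (B : G.Walk w v) (P : G.Walk u w),
    (∀ x ∈ (A.append (D.append B)).support, x ∈ U) ∧
    (∀ x ∈ P.support, x ∈ U) ∧
    (A.append (D.append B)).IsCycle ∧
    Even (A.append (D.append B)).length ∧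
    0 < A.length ∧ 0 < B.length ∧
    P.IsPath ∧
    (∀ x ∈ P.support, x ∈ (A.append (D.append B)).support → x = u ∨ x = w) ∧
    (A.append (D.append B)).getVert ((A.append (D.append B)).length / 2) ∈ D.support ∧
    (A.append (D.append B)).getVert ((A.append (D.append B)).length / 2) ≠ u ∧
    (A.append (D.append B)).getVert ((A.append (D.append B)).length / 2) ≠ w

/-- `f` is a level function rooted at `v` on the vertex set `X`: it vanishes at `v`, and every
other vertex of `X` has a neighbor in `X` whose value is smaller by one. -/
def IsLevelFunOn (G : SimpleGraph V) (v : V) (X : Finset V) (f : V → ℕ) : Prop :=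
  f v = 0 ∧ ∀ x ∈ X, x ≠ v → ∃ y ∈ X, G.Adj x y ∧ f x = f y + 1

/-- `f` and `g` are level functions rooted at `v` on `X` that differ everywhere except at `v`. -/
def IsDisjointLevelPair (G : SimpleGraph V) (v : V) (X : Finset V) (f g : V → ℕ) : Prop :=
  IsLevelFunOn G v X f ∧ IsLevelFunOn G v X g ∧ ∀ x ∈ X, x ≠ v → f x ≠ g x

/-- The list of fibers of a function `f : V → ℕ`, up to its maximal value. -/
def levelList [Fintype V] (f : V → ℕ) : List (Finset V) :=
  (List.range (Finset.univ.sup f + 1)).map fun i => Finset.univ.filter fun x => f x = i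

theorem length_levelList [Fintype V] (f : V → ℕ) :
    (levelList f).length = Finset.univ.sup f + 1 := by
  simp [levelList]

theorem mem_getD_levelList [Fintype V] (f : V → ℕ) (i : ℕ) (x : V) :
    x ∈ (levelList f).getD i ∅ ↔ f x = i := by
  have hx : f x ≤ Finset.univ.sup f := Finset.le_sup (Finset.mem_univ x)
  by_cases hi : i < Finset.univ.sup f + 1
  · simp [levelList, List.getD_eq_getElem?_getD, hi]
  · have : f x ≠ i := by omega
    simp [levelList, List.getD_eq_getElem?_getD, hi, this]

theorem IsLevelFunOn.exists_eq_of_le [Fintype V] {G : SimpleGraph V} {v : V} {f : V → ℕ}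
    (hf : IsLevelFunOn G v Finset.univ f) {i k : ℕ} (hik : i ≤ k) (hk : ∃ x, f x = k) :
    ∃ x, f x = i := by
  induction k, hik using Nat.le_induction with
  | base => exact hk
  | succ k _ ih =>
    obtain ⟨x, hx⟩ := hk
    obtain ⟨y, -, -, hy⟩ := hf.2 x (Finset.mem_univ x) (by rintro rfl; have := hf.1; omega)
    exact ih ⟨y, by omega⟩

theorem IsLevelFunOn.isLevelPartition_levelList [Fintype V] {G : SimpleGraph V} {v : V}
    {f : V → ℕ} (hf : IsLevelFunOn G v Finset.univ f) : IsLevelPartition G (levelList f) := by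
  refine ⟨?_, fun i hi => ?_, fun i j _ _ hij => ?_, fun x => ?_, fun i h1 _ x hx => ?_⟩
  · rw [← List.length_pos_iff, length_levelList]
    omega
  · rw [length_levelList] at hi
    obtain ⟨z, -, hz⟩ := Finset.exists_mem_eq_sup Finset.univ ⟨v, Finset.mem_univ v⟩ f
    obtain ⟨x, hx⟩ := hf.exists_eq_of_le (Nat.le_of_lt_succ hi) ⟨z, hz.symm⟩
    exact ⟨x, (mem_getD_levelList f i x).2 hx⟩
  · rw [Finset.disjoint_left]
    intro x hx hx'
    rw [mem_getD_levelList] at hx hx'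
    omega
  · simp only [Set.mem_univ, true_iff]
    refine ⟨f x, ?_, (mem_getD_levelList f _ x).2 rfl⟩
    rw [length_levelList]
    exact Nat.lt_succ_of_le (Finset.le_sup (Finset.mem_univ x))
  · rw [mem_getD_levelList] at hx
    obtain ⟨y, -, hxy, hy⟩ := hf.2 x (Finset.mem_univ x) (by rintro rfl; have := hf.1; omega)
    exact ⟨y, (mem_getD_levelList f _ y).2 (by omega), hxy⟩

theorem IsLevelFunOn.rootedAt_levelList [Fintype V] {G : SimpleGraph V} {v : V} {f : V → ℕ}
    (hf : IsLevelFunOn G v Finset.univ f) : RootedAt v (levelList f) := by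
  ext x
  rw [mem_getD_levelList, Finset.mem_singleton]
  refine ⟨fun hx => ?_, fun hx => hx ▸ hf.1⟩
  by_contra hne
  obtain ⟨y, -, -, hy⟩ := hf.2 x (Finset.mem_univ x) hne
  omega

theorem IsDisjointLevelPair.levelDisjoint [Fintype V] {G : SimpleGraph V} {v : V} {f g : V → ℕ}
    (h : IsDisjointLevelPair G v Finset.univ f g) :
    LevelDisjoint (levelList f) (levelList g) := by
  intro i hi _ _
  rw [Finset.disjoint_left]
  intro x hx hx'
  rw [mem_getD_levelList] at hx hx'
  refine h.2.2 x (Finset.mem_univ x) ?_ (hx.trans hx'.symm)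
  rintro rfl
  have := h.1.1
  omega

theorem IsLevelFunOn.insert [DecidableEq V] {G : SimpleGraph V} {v x z : V} {X : Finset V}
    {f : V → ℕ} (hf : IsLevelFunOn G v X f) (hv : v ∈ X) (hx : x ∈ X) (hz : z ∉ X)
    (hzx : G.Adj z x) :
    IsLevelFunOn G v (insert z X) (Function.update f z (f x + 1)) := by
  have hne : ∀ {y}, y ∈ X → y ≠ z := fun hy h => hz (h ▸ hy)
  refine ⟨by rw [Function.update_of_ne (hne hv), hf.1], fun y hy hyv => ?_⟩
  obtain rfl | hyX := Finset.mem_insert.1 hy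
  · exact ⟨x, Finset.mem_insert_of_mem hx, hzx, by
      rw [Function.update_self, Function.update_of_ne (hne hx)]⟩
  · obtain ⟨t, ht, hyt, hft⟩ := hf.2 y hyX hyv
    exact ⟨t, Finset.mem_insert_of_mem ht, hyt, by
      rw [Function.update_of_ne (hne hyX), Function.update_of_ne (hne ht), hft]⟩

theorem IsDisjointLevelPair.insert [DecidableEq V] {G : SimpleGraph V} {v x z : V}
    {X : Finset V} {f g : V → ℕ} (h : IsDisjointLevelPair G v X f g) (hv : v ∈ X) (hx : x ∈ X)
    (hxv : x ≠ v) (hz : z ∉ X) (hzx : G.Adj z x) :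
    IsDisjointLevelPair G v (insert z X) (Function.update f z (f x + 1))
      (Function.update g z (g x + 1)) := by
  refine ⟨h.1.insert hv hx hz hzx, h.2.1.insert hv hx hz hzx, fun y hy hyv => ?_⟩
  obtain rfl | hyX := Finset.mem_insert.1 hy
  · have := h.2.2 x hx hxv
    simpa using this
  · have hyz : y ≠ z := fun h => hz (h ▸ hyX)
    rw [Function.update_of_ne hyz, Function.update_of_ne hyz]
    exact h.2.2 y hyX hyv

/-- If `G - v` is connected, then every proper vertex set `X ∋ v` containing another vertex
is left by an edge avoiding `v`. -/
theorem exists_adj_notMem_of_preconnected [Fintype V] {G : SimpleGraph V} {v x : V}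
    {X : Finset V} (hG : (G.induce (Set.univ \ {v})).Preconnected) (hv : v ∈ X) (hx : x ∈ X)
    (hxv : x ≠ v) (hX : X ≠ Finset.univ) :
    ∃ y ∈ X, y ≠ v ∧ ∃ z ∉ X, G.Adj z y := by
  obtain ⟨t, ht⟩ : ∃ t, t ∉ X := by
    by_contra! h
    exact hX (Finset.eq_univ_of_forall h)
  have htv : t ≠ v := fun h => ht (h ▸ hv)
  obtain ⟨W⟩ := hG ⟨x, by simpa using hxv⟩ ⟨t, by simpa using htv⟩
  obtain ⟨e, -, he, he'⟩ := W.exists_boundary_dart {y | y.1 ∈ X} hx ht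
  exact ⟨e.fst.1, he, e.fst.2.2, e.snd.1, he', e.adj.symm⟩

/-- If `G - v` is connected, a pair of level functions differing off `v` extends from any vertex
set containing `v` and some other vertex to the whole graph. -/
theorem IsDisjointLevelPair.exists_extend [Fintype V] [DecidableEq V] {G : SimpleGraph V}
    {v x : V} (hG : (G.induce (Set.univ \ {v})).Preconnected) {X : Finset V} {f g : V → ℕ}
    (h : IsDisjointLevelPair G v X f g) (hv : v ∈ X) (hx : x ∈ X) (hxv : x ≠ v) :
    ∃ f' g', IsDisjointLevelPair G v Finset.univ f' g' := by
  induction hn : Fintype.card V - X.card generalizing X f g with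
  | zero =>
    have hX : X = Finset.univ :=
      Finset.eq_univ_of_card X (le_antisymm (Finset.card_le_univ X) (by omega))
    exact ⟨f, g, hX ▸ h⟩
  | succ n ih =>
    have hX : X ≠ Finset.univ := by
      rintro rfl
      simp at hn
    obtain ⟨y, hy, hyv, z, hz, hzy⟩ := exists_adj_notMem_of_preconnected hG hv hx hxv hX
    refine ih (h.insert hv hy hyv hz hzy) (Finset.mem_insert_of_mem hv)
      (Finset.mem_insert_of_mem hx) ?_
    rw [Finset.card_insert_of_notMem hz]
    omega

/-- A closed sequence `c` of `N` distinct vertices of `G` starting at `v`, together with a path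
`q` of length `p` meeting it exactly in its endvertices `c a` and `c e`. -/
structure IsTheta (G : SimpleGraph V) (v : V) (c q : ℕ → V) (N a e p : ℕ) : Prop where
  zero : c 0 = v
  last : c N = v
  adj : ∀ i < N, G.Adj (c i) (c (i + 1))
  inj : ∀ i < N, ∀ j < N, c i = c j → i = j
  chord_zero : q 0 = c a
  chord_last : q p = c e
  chord_adj : ∀ i < p, G.Adj (q i) (q (i + 1))
  chord_inj : ∀ i ≤ p, ∀ j ≤ p, q i = q j → i = j
  chord_off : ∀ i, 0 < i → i < p → ∀ j < N, q i ≠ c j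
  pos : 0 < a
  lt : a < e
  lt_last : e < N
  chord_pos : 0 < p

namespace IsTheta

variable {G : SimpleGraph V} {v : V} {c q : ℕ → V} {N a e p : ℕ}

theorem reverse (h : IsTheta G v c q N a e p) :
    IsTheta G v (fun i => c (N - i)) (fun i => q (p - i)) N (N - e) (N - a) p where
  zero := by simpa using h.last
  last := by simpa using h.zero
  adj i hi := by
    have := h.adj (N - (i + 1)) (by omega)
    rw [show N - (i + 1) + 1 = N - i by omega] at this
    exact this.symm
  inj i hi j hj hij := by
    have h0 := h.zero.trans h.last.symm
    have := h.lt_last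
    rcases Nat.eq_zero_or_pos i with rfl | hi' <;> rcases Nat.eq_zero_or_pos j with rfl | hj'
    · rfl
    · have := h.inj 0 (by omega) (N - j) (by omega) (by simpa [h0] using hij)
      omega
    · have := h.inj (N - i) (by omega) 0 (by omega) (by simpa [h0] using hij)
      omega
    · have := h.inj (N - i) (by omega) (N - j) (by omega) hij
      omega
  chord_zero := by
    have := h.lt_last
    simpa [show N - (N - e) = e by omega] using h.chord_last
  chord_last := by
    have := h.lt_last
    have := h.lt
    simpa [show N - (N - a) = a by omega] using h.chord_zero
  chord_adj i hi := by
    have := h.chord_adj (p - (i + 1)) (by omega)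
    rw [show p - (i + 1) + 1 = p - i by omega] at this
    exact this.symm
  chord_inj i hi j hj hij := by
    have := h.chord_inj (p - i) (by omega) (p - j) (by omega) hij
    omega
  chord_off i h0 hi j hj := by
    rcases Nat.eq_zero_or_pos j with rfl | hj'
    · have := h.chord_off (p - i) (by omega) (by omega) 0 hj
      rwa [h.zero, ← h.last] at this
    · exact h.chord_off (p - i) (by omega) (by omega) (N - j) (by omega)
  pos := by have := h.lt_last; omega
  lt := by have := h.lt_last; have := h.lt; omega
  lt_last := by have := h.pos; have := h.lt; have := h.lt_last; omega
  chord_pos := h.chord_pos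

/-- A function on a theta graph can be prescribed by position. -/
theorem exists_fun (h : IsTheta G v c q N a e p) (F Q : ℕ → ℕ) :
    ∃ f : V → ℕ, (∀ i < N, f (c i) = F i) ∧ ∀ i, 0 < i → i < p → f (q i) = Q i := by
  classical
  refine ⟨fun x => if hx : ∃ i < N, c i = x then F hx.choose else
    if hx : ∃ i, 0 < i ∧ i < p ∧ q i = x then Q hx.choose else 0, fun i hi => ?_,
    fun i h0 hi => ?_⟩
  · have hx : ∃ j < N, c j = c i := ⟨i, hi, rfl⟩
    simp only [dif_pos hx]
    rw [h.inj _ hx.choose_spec.1 i hi hx.choose_spec.2]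
  · have hx : ¬ ∃ j < N, c j = q i := fun ⟨j, hj, hji⟩ => h.chord_off i h0 hi j hj hji.symm
    have hy : ∃ j, 0 < j ∧ j < p ∧ q j = q i := ⟨i, h0, hi, rfl⟩
    simp only [dif_neg hx, dif_pos hy]
    obtain ⟨-, hj, hji⟩ := hy.choose_spec
    rw [h.chord_inj _ hj.le i hi.le hji]

/-- The vertices of a theta graph. -/
def verts [DecidableEq V] (c q : ℕ → V) (N p : ℕ) : Finset V :=
  (Finset.range N).image c ∪ (Finset.Ioo 0 p).image q

theorem mem_verts [DecidableEq V] {x : V} :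
    x ∈ verts c q N p ↔ (∃ i < N, c i = x) ∨ ∃ i, (0 < i ∧ i < p) ∧ q i = x := by
  simp [verts]

theorem chord_mem_verts [DecidableEq V] (h : IsTheta G v c q N a e p) {i : ℕ} (hi : i ≤ p) :
    q i ∈ verts c q N p := by
  have := h.lt
  have := h.lt_last
  rcases Nat.eq_zero_or_pos i with rfl | h0
  · exact mem_verts.2 (.inl ⟨a, by omega, h.chord_zero.symm⟩)
  · rcases hi.lt_or_eq with hi | rfl
    · exact mem_verts.2 (.inr ⟨i, ⟨h0, hi⟩, rfl⟩)
    · exact mem_verts.2 (.inl ⟨e, by omega, h.chord_last.symm⟩)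

/-- The first level function runs once around the cycle and enters the chordal path at `c e`;
the second runs backwards to `c e`, then along the chordal path to `c a`, and from there in both
directions along the cycle. -/
theorem exists_isDisjointLevelPair_of_lt [DecidableEq V] (h : IsTheta G v c q N a e p)
    (he : N - e < e) (ha : a < N - e + p) :
    ∃ f g, IsDisjointLevelPair G v (verts c q N p) f g := by
  have hpos := h.pos
  have hlt := h.lt
  have hlast := h.lt_last
  have hp := h.chord_pos
  obtain ⟨f, hfc, hfq⟩ := h.exists_fun (fun i => i) (fun i => e + (p - i))
  obtain ⟨g, hgc, hgq⟩ := h.exists_fun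
    (fun i => if i = 0 then 0 else if i ≤ a then N - e + p + (a - i) else
      if i < e then N - e + p + (i - a) else N - i) (fun i => N - e + (p - i))
  have hfq' : ∀ i, 0 < i → i ≤ p → f (q i) = e + (p - i) := fun i h0 hi => by
    rcases hi.lt_or_eq with hi | rfl
    · exact hfq i h0 hi
    · rw [h.chord_last, hfc e hlast, Nat.sub_self, Nat.add_zero]
  have hgq' : ∀ i ≤ p, g (q i) = N - e + (p - i) := fun i hi => by
    rcases Nat.eq_zero_or_pos i with rfl | h0
    · rw [h.chord_zero, hgc a (by omega)]
      grind
    · rcases hi.lt_or_eq with hi | rfl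
      · exact hgq i h0 hi
      · rw [h.chord_last, hgc e hlast]
        grind
  have hfv : f v = 0 := by rw [← h.zero, hfc 0 (by omega)]
  have hgv : g v = 0 := by rw [← h.zero, hgc 0 (by omega), if_pos rfl]
  have hgN : ∀ i, e ≤ i → i ≤ N → g (c i) = N - i := fun i hi hiN => by
    rcases hiN.lt_or_eq with hiN | rfl
    · rw [hgc i hiN]
      grind
    · rw [h.last, hgv, Nat.sub_self]
  have hmem : ∀ i ≤ N, c i ∈ verts c q N p := fun i hi => by
    rcases hi.lt_or_eq with hi | rfl
    · exact mem_verts.2 (.inl ⟨i, hi, rfl⟩)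
    · exact mem_verts.2 (.inl ⟨0, by omega, h.zero.trans h.last.symm⟩)
  refine ⟨f, g, ⟨hfv, fun x hx hxv => ?_⟩, ⟨hgv, fun x hx hxv => ?_⟩, fun x hx hxv => ?_⟩
  · rcases mem_verts.1 hx with ⟨i, hi, rfl⟩ | ⟨i, ⟨h0, hi⟩, rfl⟩
    · obtain ⟨k, rfl⟩ : ∃ k, i = k + 1 :=
        Nat.exists_eq_succ_of_ne_zero (by rintro rfl; exact hxv h.zero)
      exact ⟨c k, hmem k (by omega), (h.adj k (by omega)).symm, by
        rw [hfc _ hi, hfc k (by omega)]⟩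
    · refine ⟨q (i + 1), h.chord_mem_verts hi, h.chord_adj i hi, ?_⟩
      rw [hfq' i h0 hi.le, hfq' (i + 1) (by omega) hi]
      omega
  · rcases mem_verts.1 hx with ⟨i, hi, rfl⟩ | ⟨i, ⟨h0, hi⟩, rfl⟩
    · have hi0 : i ≠ 0 := by rintro rfl; exact hxv h.zero
      rcases lt_trichotomy i a with hia | rfl | hia
      · refine ⟨c (i + 1), hmem _ hi, h.adj i hi, ?_⟩
        rw [hgc i hi, hgc (i + 1) (by omega)]
        grind
      · refine ⟨q 1, h.chord_mem_verts hp, h.chord_zero ▸ h.chord_adj 0 hp, ?_⟩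
        rw [← h.chord_zero, hgq' 0 (by omega), hgq' 1 hp]
        omega
      · by_cases hie : i < e
        · obtain ⟨k, rfl⟩ := Nat.exists_eq_succ_of_ne_zero hi0
          refine ⟨c k, hmem k (by omega), (h.adj k (by omega)).symm, ?_⟩
          rw [hgc _ hi, hgc k (by omega)]
          grind
        · refine ⟨c (i + 1), hmem _ hi, h.adj i hi, ?_⟩
          rw [hgN i (by omega) hi.le, hgN (i + 1) (by omega) hi]
          omega
    · refine ⟨q (i + 1), h.chord_mem_verts hi, h.chord_adj i hi, ?_⟩
      rw [hgq' i hi.le, hgq' (i + 1) hi]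
      omega
  · rcases mem_verts.1 hx with ⟨i, hi, rfl⟩ | ⟨i, ⟨h0, hi⟩, rfl⟩
    · have hi0 : i ≠ 0 := by rintro rfl; exact hxv h.zero
      rw [hfc i hi, hgc i hi]
      grind
    · rw [hfq i h0 hi, hgq i h0 hi]
      omega

theorem exists_isDisjointLevelPair [DecidableEq V] (h : IsTheta G v c q N a e p)
    (ha : a < N - a) (he : N - e < e) :
    ∃ X : Finset V, v ∈ X ∧ (∃ x ∈ X, x ≠ v) ∧ ∃ f g, IsDisjointLevelPair G v X f g := by
  have key : ∀ {c' q' : ℕ → V} {a' e' : ℕ}, IsTheta G v c' q' N a' e' p →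
      v ∈ verts c' q' N p ∧ ∃ x ∈ verts c' q' N p, x ≠ v := fun {c' q' a' e'} h' => by
    have h1 := h'.pos
    have h2 := h'.lt
    have h3 := h'.lt_last
    refine ⟨mem_verts.2 (.inl ⟨0, by omega, h'.zero⟩), c' a',
      mem_verts.2 (.inl ⟨a', by omega, rfl⟩), fun h4 => ?_⟩
    have := h'.inj a' (by omega) 0 (by omega) (h4.trans h'.zero.symm)
    omega
  have hpos := h.pos
  have hlt := h.lt
  have hlast := h.lt_last
  have hp := h.chord_pos
  by_cases hap : a < N - e + p
  · exact ⟨_, (key h).1, (key h).2, h.exists_isDisjointLevelPair_of_lt he hap⟩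
  · exact ⟨_, (key h.reverse).1, (key h.reverse).2,
      h.reverse.exists_isDisjointLevelPair_of_lt (by omega) (by omega)⟩

end IsTheta

theorem HasSepChordalCycleIn.exists_isTheta {G : SimpleGraph V} {U : Set V} {v : V}
    (h : HasSepChordalCycleIn G U v) :
    ∃ (c q : ℕ → V) (N a e p : ℕ), IsTheta G v c q N a e p ∧ a < N - a ∧ N - e < e := by
  obtain ⟨u, w, A, D, B, P, -, -, hC, hev, hA, hB, hP, hPC, hmem, hu, hw⟩ := h
  have hcA : (A.append (D.append B)).getVert A.length = u := by
    simp [Walk.getVert_append]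
  have hcD : ∀ j ≤ D.length, (A.append (D.append B)).getVert (A.length + j) = D.getVert j := by
    intro j hj
    rw [Walk.getVert_append, if_neg (by omega), Nat.add_sub_cancel_left, Walk.getVert_append]
    rcases hj.lt_or_eq with hj | rfl
    · rw [if_pos hj]
    · simp
  have hN : (A.append (D.append B)).length = A.length + D.length + B.length := by
    simp [Walk.length_append, Nat.add_assoc]
  have hcw := hcD D.length le_rfl
  rw [Walk.getVert_length] at hcw
  generalize A.append (D.append B) = C at *
  have hinj : ∀ i < C.length, ∀ j < C.length, C.getVert i = C.getVert j → i = j :=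
    fun i hi j hj hij => hC.getVert_injOn' (by simp; omega) (by simp; omega) hij
  obtain ⟨j, hj, hjD⟩ := Walk.mem_support_iff_exists_getVert.1 hmem
  rw [← hcD j hjD] at hj
  have hjn := hinj _ (by omega) _ (by omega) hj
  have hj0 : j ≠ 0 := by
    rintro rfl
    exact hu (by rw [← hj, Nat.add_zero, hcA])
  have hjd : j ≠ D.length := by
    rintro rfl
    exact hw (by rw [← hj, hcw])
  have huw : u ≠ w := by
    intro h
    have := hinj A.length (by omega) (A.length + D.length) (by omega) (by rw [hcA, hcw, h])
    omega
  have hPinj : ∀ i ≤ P.length, ∀ j ≤ P.length, P.getVert i = P.getVert j → i = j :=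
    fun i hi j hj hij => hP.getVert_injOn hi hj hij
  obtain ⟨n, hn⟩ := hev
  refine ⟨C.getVert, P.getVert, C.length, A.length, A.length + D.length, P.length, ?_,
    by omega, by omega⟩
  refine ⟨C.getVert_zero, C.getVert_length, fun i hi => C.adj_getVert_succ hi, hinj,
    by rw [P.getVert_zero, hcA], by rw [P.getVert_length, hcw],
    fun i hi => P.adj_getVert_succ hi, hPinj, fun i h0 hi k hk hik => ?_, hA, by omega, by omega,
    Nat.pos_of_ne_zero fun h => huw (Walk.eq_of_length_eq_zero h)⟩
  rcases hPC _ (P.getVert_mem_support i) (hik ▸ C.getVert_mem_support k) with h | h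
  · have := hPinj i hi.le 0 (by omega) (by rw [h, P.getVert_zero])
    omega
  · have := hPinj i hi.le P.length le_rfl (by rw [h, P.getVert_length])
    omega

/-- If a finite 2-connected bipartite graph `G` contains an even cycle
`C` through `v` together with a chordal path to `C` separating `v` and `v̄_C`, then `G`
has two level-disjoint partitions rooted at `v`. -/
theorem two_connected_bipartite_two_rooted_LDPs {V : Type*} [Fintype V] [DecidableEq V]
    (G : SimpleGraph V) (h2c : TwoConnectedOn G Set.univ)
    (hbip : G.Colorable 2) (v : V)
    (hcyc : HasSepChordalCycleIn G Set.univ v) :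
    ∃ S T : List (Finset V),
      IsLevelPartition G S ∧ RootedAt v S ∧
      IsLevelPartition G T ∧ RootedAt v T ∧ LevelDisjoint S T := by
  obtain ⟨c, q, N, a, e, p, hθ, ha, he⟩ := hcyc.exists_isTheta
  obtain ⟨X, hv, ⟨x, hx, hxv⟩, f₀, g₀, h₀⟩ := hθ.exists_isDisjointLevelPair ha he
  obtain ⟨f, g, h⟩ := h₀.exists_extend (h2c.2.2 v (Set.mem_univ v)) hv hx hxv
  exact ⟨levelList f, levelList g, h.1.isLevelPartition_levelList, h.1.rootedAt_levelList,
    h.2.1.isLevelPartition_levelList, h.2.1.rootedAt_levelList, h.levelDisjoint⟩
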